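/- Let F be a field of characteristic different from 2 and A = (α, β)_F the quaternion algebra over F with α, β ∈ F^×, with canonical involution ρ. Let T(A) be the tensor algebra of the underlying F-vector space of A, with canonical inclusion ι : A → T(A), and let m : A ⊗_F A → T(A) be the linear map with m(x ⊗ y) = ι(x)·ι(y). Let μ : A ⊗_F A → A be the multiplication map x ⊗ y ↦ x·y. Then the quotient of T(A) by the two-sided ideal generated by {ι(q) : q ∈ A, ρ(q) = −q} ∪ {m(s) : s ∈ ker μ} is isomorphic as an F-algebra to F[X]/(X²) (the dual numbers over F). -/

import Mathlib

open Quaternion TensorProduct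

/-- The relation on the tensor algebra `T(A)` whose associated `RingQuot` is the
quotient of `T(A)` by the two-sided ideal generated by the skew elements
`{ι(q) : ρ(q) = −q}` (here `ρ = star`) together with `{m(s) : s ∈ ker μ}`, where
`m : A ⊗ A → T(A)` sends `x ⊗ y` to `ι(x)·ι(y)` and `μ : A ⊗ A → A` is the
multiplication map. -/
def cliffordInvRel (F A : Type*) [Field F] [Ring A] [Algebra F A] [StarRing A]
    (m : A ⊗[F] A →ₗ[F] TensorAlgebra F A) :
    TensorAlgebra F A → TensorAlgebra F A → Prop := fun x y =>
  y = 0 ∧ ((∃ q : A, star q = -q ∧ x = TensorAlgebra.ι F q) ∨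
    (∃ s ∈ LinearMap.ker (LinearMap.mul' F A), x = m s))

namespace CliffordInv

variable {F : Type*} [Field F] {α β : F}

/-- The linear map `q ↦ re(q) ε` from a quaternion algebra to the dual numbers. -/
def reEps (F : Type*) [Field F] (α β : F) : ℍ[F, α, β] →ₗ[F] DualNumber F :=
  (TrivSqZeroExt.inrHom F F).comp (QuaternionAlgebra.reₗ α 0 β)

@[simp]
theorem reEps_apply (q : ℍ[F, α, β]) : reEps F α β q = TrivSqZeroExt.inr q.re := rfl

/-- A quaternion which is skew for the canonical involution has zero real part. -/
theorem re_eq_zero_of_star_eq_neg (hF : (2 : F) ≠ 0) {q : ℍ[F, α, β]} (hq : star q = -q) :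
    q.re = 0 := by
  have h : q.re = -q.re := by simpa using congrArg QuaternionAlgebra.re hq
  have h2 : 2 * q.re = 0 := by linear_combination h
  exact (mul_eq_zero.mp h2).resolve_left hF

variable {m : ℍ[F, α, β] ⊗[F] ℍ[F, α, β] →ₗ[F] TensorAlgebra F ℍ[F, α, β]}

/-- The algebra map extending `reEps` kills all products of two vectors. -/
theorem lift_reEps_apply
    (hm : ∀ x y : ℍ[F, α, β],
      m (x ⊗ₜ[F] y) = TensorAlgebra.ι F x * TensorAlgebra.ι F y)
    (s : ℍ[F, α, β] ⊗[F] ℍ[F, α, β]) :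
    TensorAlgebra.lift F (reEps F α β) (m s) = 0 := by
  induction s with
  | zero => simp
  | tmul x y => simp [hm]
  | add x y hx hy => simp [hx, hy]

/-- The map from the quotient to the dual numbers induced by `reEps`. -/
def toDual (hF : (2 : F) ≠ 0)
    (hm : ∀ x y : ℍ[F, α, β],
      m (x ⊗ₜ[F] y) = TensorAlgebra.ι F x * TensorAlgebra.ι F y) :
    RingQuot (cliffordInvRel F ℍ[F, α, β] m) →ₐ[F] DualNumber F :=
  RingQuot.liftAlgHom F ⟨TensorAlgebra.lift F (reEps F α β), by
    rintro x y ⟨rfl, ⟨q, hq, rfl⟩ | ⟨s, -, rfl⟩⟩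
    · simp [re_eq_zero_of_star_eq_neg hF hq]
    · rw [lift_reEps_apply hm, map_zero]⟩

/-- The image of a vector in the quotient of the tensor algebra. -/
def quotι (m : ℍ[F, α, β] ⊗[F] ℍ[F, α, β] →ₗ[F] TensorAlgebra F ℍ[F, α, β]) :
    ℍ[F, α, β] →ₗ[F] RingQuot (cliffordInvRel F ℍ[F, α, β] m) :=
  (RingQuot.mkAlgHom F (cliffordInvRel F ℍ[F, α, β] m)).toLinearMap.comp (TensorAlgebra.ι F)

theorem quotι_apply (q : ℍ[F, α, β]) :
    quotι m q = RingQuot.mkAlgHom F (cliffordInvRel F ℍ[F, α, β] m) (TensorAlgebra.ι F q) := rfl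

theorem quotι_eq_zero {q : ℍ[F, α, β]} (hq : star q = -q) : quotι m q = 0 := by
  rw [quotι_apply, ← map_zero (RingQuot.mkAlgHom F (cliffordInvRel F ℍ[F, α, β] m))]
  exact RingQuot.mkAlgHom_rel F ⟨rfl, Or.inl ⟨q, hq, rfl⟩⟩

theorem quotι_eq_smul (q : ℍ[F, α, β]) : quotι m q = q.re • quotι m 1 := by
  rw [← sub_eq_zero, ← map_smul, ← map_sub]
  apply quotι_eq_zero
  ext <;> simp

theorem quotι_one_mul_self (hα : α ≠ 0)
    (hm : ∀ x y : ℍ[F, α, β],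
      m (x ⊗ₜ[F] y) = TensorAlgebra.ι F x * TensorAlgebra.ι F y) :
    quotι m 1 * quotι m 1 = 0 := by
  let i : ℍ[F, α, β] := ⟨0, 1, 0, 0⟩
  have hi : quotι m i = 0 := quotι_eq_zero (by ext <;> simp [i])
  have hker : i ⊗ₜ[F] i - α • ((1 : ℍ[F, α, β]) ⊗ₜ[F] (1 : ℍ[F, α, β])) ∈
      LinearMap.ker (LinearMap.mul' F ℍ[F, α, β]) := by
    rw [LinearMap.mem_ker, map_sub, map_smul, LinearMap.mul'_apply, LinearMap.mul'_apply]
    ext <;> simp [i]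
  have hrel := RingQuot.mkAlgHom_rel F
    (show cliffordInvRel F ℍ[F, α, β] m _ 0 from ⟨rfl, Or.inr ⟨_, hker, rfl⟩⟩)
  rw [map_sub, map_smul, hm, hm, map_sub, map_smul, map_mul, map_mul, map_zero,
    ← quotι_apply, ← quotι_apply, hi, zero_mul, zero_sub, neg_eq_zero] at hrel
  exact (smul_eq_zero.mp hrel).resolve_left hα

/-- The map from the dual numbers to the quotient sending `ε` to the class of `ι 1`. -/
def ofDual (hα : α ≠ 0)
    (hm : ∀ x y : ℍ[F, α, β],
      m (x ⊗ₜ[F] y) = TensorAlgebra.ι F x * TensorAlgebra.ι F y) :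
    DualNumber F →ₐ[F] RingQuot (cliffordInvRel F ℍ[F, α, β] m) :=
  DualNumber.lift ⟨(Algebra.ofId F _, quotι m 1), quotι_one_mul_self hα hm,
    fun r => (Algebra.commutes r _).symm⟩

theorem ofDual_inr (hα : α ≠ 0)
    (hm : ∀ x y : ℍ[F, α, β],
      m (x ⊗ₜ[F] y) = TensorAlgebra.ι F x * TensorAlgebra.ι F y) (r : F) :
    ofDual hα hm (TrivSqZeroExt.inr r) = r • quotι m 1 := by
  rw [DualNumber.inr_eq_smul_eps, map_smul, ofDual, DualNumber.lift_apply_eps]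

theorem toDual_quotι (hF : (2 : F) ≠ 0)
    (hm : ∀ x y : ℍ[F, α, β],
      m (x ⊗ₜ[F] y) = TensorAlgebra.ι F x * TensorAlgebra.ι F y) (q : ℍ[F, α, β]) :
    toDual hF hm (quotι m q) = TrivSqZeroExt.inr q.re := by
  rw [quotι_apply, toDual, RingQuot.liftAlgHom_mkAlgHom_apply, TensorAlgebra.lift_ι_apply,
    reEps_apply]

end CliffordInv

/-- Let `A = (α, β)_F` be a quaternion algebra over a field `F` of
characteristic ≠ 2, with canonical involution `ρ = star`.  The quotient of the tensor
algebra `T(A)` by the two-sided ideal generated by the pure quaternions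
`{ι(q) : ρ(q) = −q}` and by `{ι(x)·ι(y) summed over x ⊗ y ∈ ker μ}` (`μ` the
multiplication of `A`) is isomorphic, as an `F`-algebra, to the dual numbers
`F[X]/(X²)`. -/
theorem clifford_stmt_19 (F : Type*) [Field F] (hF : (2 : F) ≠ 0)
    (α β : F) (hα : α ≠ 0) (hβ : β ≠ 0)
    (m : ℍ[F, α, β] ⊗[F] ℍ[F, α, β] →ₗ[F] TensorAlgebra F ℍ[F, α, β])
    (hm : ∀ x y : ℍ[F, α, β],
      m (x ⊗ₜ[F] y) = TensorAlgebra.ι F x * TensorAlgebra.ι F y) :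
    Nonempty (RingQuot (cliffordInvRel F ℍ[F, α, β] m) ≃ₐ[F] DualNumber F) := by
  refine ⟨AlgEquiv.ofAlgHom (CliffordInv.toDual hF hm) (CliffordInv.ofDual hα hm) ?_ ?_⟩
  · apply DualNumber.algHom_ext
    rw [AlgHom.comp_apply, DualNumber.eps, CliffordInv.ofDual_inr, map_smul,
      CliffordInv.toDual_quotι]
    simp
  · apply RingQuot.ringQuot_ext'
    apply TensorAlgebra.hom_ext
    ext1 q
    change CliffordInv.ofDual hα hm (CliffordInv.toDual hF hm (CliffordInv.quotι m q)) =
      CliffordInv.quotι m q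
    rw [CliffordInv.toDual_quotι, CliffordInv.ofDual_inr, ← CliffordInv.quotι_eq_smul]
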